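/- Let n ≥ 1, r > 0, and let δ : (0,∞) → ℝ be a twice continuously differentiable function. Let S_r = {x ∈ ℝ^{n+1} : |x| = r} with outward unit normal ν(p) = p/r, and for a smooth function u : ℝ^{n+1} → ℝ let ∇^T u = ∇u − ⟨∇u, ν⟩ν denote the tangential gradient along S_r. Then the following are equivalent: (a) δ''(r) ≥ 0; (b) for every smooth function u : ℝ^{n+1} → ℝ with ∫_{S_r} u dH^n = 0, one has ∫_{S_r} (|∇^T u|² − (n/r²) u²) dH^n + δ''(r) ∫_{S_r} u² dH^n ≥ 0. -/

import Mathlib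

open Filter MeasureTheory Set RealInnerProductSpace

open ProbabilityTheory in
lemma gaussPDF_hasDeriv (x : ℝ) :
    HasDerivAt (fun y => - gaussianPDFReal 0 1 y) (gaussianPDFReal 0 1 x * x) x := by
  have : (fun y => - gaussianPDFReal 0 1 y)
      = fun y : ℝ => -((√(2 * Real.pi * 1))⁻¹ * Real.exp (-(y - 0) ^ 2 / (2 * 1))) := by
    ext y; simp [gaussianPDFReal]
  rw [this]
  have h1 : HasDerivAt (fun y : ℝ => -(y - 0) ^ 2 / (2 * 1)) (-x) x := by
    have := (((hasDerivAt_id x).sub_const 0).pow 2).neg.div_const (2 * 1)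
    refine this.congr_deriv ?_
    simp
    ring
  refine ((h1.exp.const_mul _).neg).congr_deriv ?_
  simp [gaussianPDFReal]
  ring

open ProbabilityTheory in
lemma gaussPDF_tendsto : Tendsto (fun y => - gaussianPDFReal 0 1 y) atTop (nhds 0) := by
  have : (fun y => - gaussianPDFReal 0 1 y)
      = fun y : ℝ => -((√(2 * Real.pi * 1))⁻¹ * Real.exp (-(y ^ 2 / 2))) := by
    ext y; simp [gaussianPDFReal]; left; ring_nf
  rw [this]
  have h : Tendsto (fun y : ℝ => Real.exp (-(y ^ 2 / 2))) atTop (nhds 0) := by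
    apply Real.tendsto_exp_neg_atTop_nhds_zero.comp
    exact (tendsto_pow_atTop two_ne_zero).atTop_div_const (by norm_num)
  simpa using (h.const_mul _).neg

open ProbabilityTheory in
lemma gauss_integrable_id : Integrable (fun x : ℝ => x) (gaussianReal 0 1) := by
  have := (memLp_id_gaussianReal (μ := 0) (v := 1) 1).integrable (by simp)
  exact this

open ProbabilityTheory in
lemma gauss_integral_Ioi (t : ℝ) :
    ∫ x in Ioi t, x ∂(gaussianReal 0 1) = gaussianPDFReal 0 1 t := by
  have hint : IntegrableOn (fun x => gaussianPDFReal 0 1 x * x) (Ioi t) volume := by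
    have h := gauss_integrable_id
    rw [gaussianReal_of_var_ne_zero _ one_ne_zero,
      integrable_withDensity_iff_integrable_smul' (measurable_gaussianPDF _ _)
      (ae_of_all _ fun _ ↦ gaussianPDF_lt_top)] at h
    simpa using h.integrableOn
  rw [gaussianReal_of_var_ne_zero _ one_ne_zero,
    setIntegral_withDensity_eq_setIntegral_toReal_smul (measurable_gaussianPDF _ _)
      (ae_of_all _ fun _ ↦ gaussianPDF_lt_top) _ measurableSet_Ioi]
  have := integral_Ioi_of_hasDerivAt_of_tendsto' (a := t) (fun x _ => gaussPDF_hasDeriv x) hint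
    gaussPDF_tendsto
  simpa using this

open ProbabilityTheory in
lemma gauss_integral_Iic (t : ℝ) :
    ∫ x in Iic t, x ∂(gaussianReal 0 1) = - gaussianPDFReal 0 1 t := by
  have h := integral_add_compl (measurableSet_Ioi (a := t)) gauss_integrable_id
  rw [gauss_integral_Ioi, compl_Ioi, integral_id_gaussianReal] at h
  linarith

open ProbabilityTheory in
/-- the kernel identity behind the sharp one-dimensional Gaussian inequality -/
lemma gauss_kernel (t : ℝ) :
    ∫⁻ x in Ioi t, ∫⁻ y in Iic t, ENNReal.ofReal (x - y) ∂(gaussianReal 0 1) ∂(gaussianReal 0 1)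
      = gaussianPDF 0 1 t := by
  set γ := gaussianReal 0 1 with hγ
  have hA : ∫⁻ x in Ioi t, ENNReal.ofReal (x - t) ∂γ
      = ENNReal.ofReal (gaussianPDFReal 0 1 t - t * γ.real (Ioi t)) := by
    rw [← ofReal_integral_eq_lintegral_ofReal]
    · rw [integral_sub gauss_integrable_id.integrableOn (integrable_const _)]
      rw [gauss_integral_Ioi]
      simp [mul_comm, hγ]
    · exact (gauss_integrable_id.integrableOn).sub (integrable_const _)
    · refine (ae_restrict_iff' measurableSet_Ioi).2 (ae_of_all _ fun x hx => ?_)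
      exact sub_nonneg.2 (le_of_lt hx)
  have hB : ∫⁻ x in Iic t, ENNReal.ofReal (t - x) ∂γ
      = ENNReal.ofReal (gaussianPDFReal 0 1 t + t * γ.real (Iic t)) := by
    rw [← ofReal_integral_eq_lintegral_ofReal]
    · rw [integral_sub (integrable_const _) gauss_integrable_id.integrableOn]
      rw [gauss_integral_Iic]
      simp [mul_comm, add_comm, hγ]
    · exact (integrable_const _).sub (gauss_integrable_id.integrableOn)
    · refine (ae_restrict_iff' measurableSet_Iic).2 (ae_of_all _ fun x hx => ?_)
      exact sub_nonneg.2 hx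
  have hA0 : 0 ≤ gaussianPDFReal 0 1 t - t * γ.real (Ioi t) := by
    have : ∫ x in Ioi t, (x - t) ∂γ = gaussianPDFReal 0 1 t - t * γ.real (Ioi t) := by
      rw [integral_sub gauss_integrable_id.integrableOn (integrable_const _)]
      rw [gauss_integral_Ioi]
      simp [mul_comm, hγ]
    rw [← this]
    exact setIntegral_nonneg measurableSet_Ioi fun x hx => sub_nonneg.2 (le_of_lt hx)
  have hB0 : 0 ≤ gaussianPDFReal 0 1 t + t * γ.real (Iic t) := by
    have : ∫ x in Iic t, (t - x) ∂γ = gaussianPDFReal 0 1 t + t * γ.real (Iic t) := by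
      rw [integral_sub (integrable_const _) gauss_integrable_id.integrableOn]
      rw [gauss_integral_Iic]
      simp [mul_comm, add_comm, hγ]
    rw [← this]
    exact setIntegral_nonneg measurableSet_Iic fun x hx => sub_nonneg.2 hx
  have hpq : γ.real (Ioi t) + γ.real (Iic t) = 1 := by
    have := measureReal_add_measureReal_compl (μ := γ) (measurableSet_Ioi (a := t))
    simpa using this
  calc _ = ∫⁻ x in Ioi t, (ENNReal.ofReal (x - t) * γ (Iic t)
            + ∫⁻ y in Iic t, ENNReal.ofReal (t - y) ∂γ) ∂γ := by
        refine setLIntegral_congr_fun measurableSet_Ioi fun x hx => ?_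
        have : ∫⁻ y in Iic t, ENNReal.ofReal (x - y) ∂γ
            = ∫⁻ y in Iic t, (ENNReal.ofReal (x - t) + ENNReal.ofReal (t - y)) ∂γ := by
          refine setLIntegral_congr_fun measurableSet_Iic fun y hy => ?_
          rw [← ENNReal.ofReal_add (sub_nonneg.2 (le_of_lt hx)) (sub_nonneg.2 hy)]
          congr 1; ring
        rw [this, lintegral_add_left measurable_const]
        simp
    _ = ENNReal.ofReal (gaussianPDFReal 0 1 t - t * γ.real (Ioi t)) * γ (Iic t)
        + ENNReal.ofReal (gaussianPDFReal 0 1 t + t * γ.real (Iic t)) * γ (Ioi t) := by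
        rw [lintegral_add_right _ measurable_const, lintegral_mul_const _ (by fun_prop), hA, hB]
        simp
    _ = gaussianPDF 0 1 t := by
        rw [← ofReal_measureReal (μ := γ) (s := Iic t), ← ofReal_measureReal (μ := γ) (s := Ioi t),
          ← ENNReal.ofReal_mul hA0, ← ENNReal.ofReal_mul hB0, ← ENNReal.ofReal_add
          (mul_nonneg hA0 measureReal_nonneg) (mul_nonneg hB0 measureReal_nonneg), gaussianPDF]
        congr 1
        linear_combination (gaussianPDFReal 0 1 t) * hpq

lemma cs_interval (f f' : ℝ → ℝ) (hf : ∀ x, HasDerivAt f (f' x) x) (hf' : Continuous f')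
    {y x : ℝ} (h : y < x) : (f x - f y) ^ 2 ≤ (x - y) * ∫ t in y..x, f' t ^ 2 := by
  have hi : ∫ t in y..x, f' t = f x - f y :=
    intervalIntegral.integral_eq_sub_of_hasDerivAt (fun t _ => hf t) (hf'.intervalIntegrable _ _)
  set c := (f x - f y) / (x - y) with hc
  have hxy : 0 < x - y := sub_pos.2 h
  have h0 : 0 ≤ ∫ t in y..x, (f' t - c) ^ 2 :=
    intervalIntegral.integral_nonneg h.le fun t _ => sq_nonneg _
  have h1 : ∫ t in y..x, (f' t - c) ^ 2
      = (∫ t in y..x, f' t ^ 2) - 2 * c * (f x - f y) + c ^ 2 * (x - y) := by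
    have : ∀ t, (f' t - c) ^ 2 = f' t ^ 2 - 2 * c * f' t + c ^ 2 := fun t => by ring
    simp_rw [this]
    rw [intervalIntegral.integral_add, intervalIntegral.integral_sub,
      intervalIntegral.integral_const_mul, hi]
    · simp [mul_comm]
    · exact (by fun_prop : Continuous fun t => f' t ^ 2).intervalIntegrable _ _
    · exact (by fun_prop : Continuous fun t => 2 * c * f' t).intervalIntegrable _ _
    · exact (by fun_prop : Continuous fun t => f' t ^ 2 - 2 * c * f' t).intervalIntegrable _ _
    · exact continuous_const.intervalIntegrable _ _
  have h2 : c * (x - y) = f x - f y := by rw [hc]; field_simp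
  have h3 : 0 ≤ (x - y) * ((∫ t in y..x, f' t ^ 2) - 2 * c * (f x - f y) + c ^ 2 * (x - y)) :=
    mul_nonneg hxy.le (h1 ▸ h0)
  have h4 : (x - y) * ((∫ t in y..x, f' t ^ 2) - 2 * c * (f x - f y) + c ^ 2 * (x - y))
     = (x - y) * (∫ t in y..x, f' t ^ 2) - (f x - f y) ^ 2 := by
    linear_combination (-(2 * (f x - f y)) + c * (x - y) + (f x - f y)) * h2
  linarith

lemma cs_interval_lintegral (f f' : ℝ → ℝ) (hf : ∀ x, HasDerivAt f (f' x) x)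
    (hf' : Continuous f') {y x : ℝ} (h : y < x) :
    ENNReal.ofReal ((f x - f y) ^ 2)
      ≤ ∫⁻ t in Ico y x, ENNReal.ofReal (x - y) * ENNReal.ofReal (f' t ^ 2) := by
  have h1 := cs_interval f f' hf hf' h
  rw [lintegral_const_mul _ (by fun_prop)]
  refine (ENNReal.ofReal_le_ofReal h1).trans ?_
  rw [ENNReal.ofReal_mul (sub_pos.2 h).le, intervalIntegral.integral_of_le h.le,
    ← integral_Ico_eq_integral_Ioc,
    ofReal_integral_eq_lintegral_ofReal]
  · exact ((by fun_prop : Continuous fun t => f' t ^ 2).integrableOn_Icc).mono_set Ico_subset_Icc_self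
  · exact ae_of_all _ fun t => sq_nonneg _

open ProbabilityTheory in
lemma gauss_half (g : ℝ → ENNReal) (hg : Measurable g) :
    ∫⁻ x, ∫⁻ y, (∫⁻ t in Ico y x, ENNReal.ofReal (x - y) * g t)
      ∂(gaussianReal 0 1) ∂(gaussianReal 0 1) = ∫⁻ t, g t ∂(gaussianReal 0 1) := by
  set γ := gaussianReal 0 1 with hγ
  set F : ℝ → ℝ → ℝ → ENNReal := fun x y t =>
    (Ioi t).indicator (fun x' => (Iic t).indicator (fun y' => ENNReal.ofReal (x' - y')) y) x * g t
    with hF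
  have hset1 : MeasurableSet {q : ℝ × ℝ × ℝ | q.2.2 < q.1} :=
    measurableSet_lt (by fun_prop) (by fun_prop)
  have hset2 : MeasurableSet {q : ℝ × ℝ × ℝ | q.2.1 ≤ q.2.2} :=
    measurableSet_le (by fun_prop) (by fun_prop)
  have hFm : Measurable fun q : ℝ × ℝ × ℝ => F q.1 q.2.1 q.2.2 := by
    have : (fun q : ℝ × ℝ × ℝ => F q.1 q.2.1 q.2.2) = fun q =>
      {q : ℝ × ℝ × ℝ | q.2.2 < q.1}.indicator ({q : ℝ × ℝ × ℝ | q.2.1 ≤ q.2.2}.indicator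
        (fun q => ENNReal.ofReal (q.1 - q.2.1))) q * g q.2.2 := by
      ext q
      simp only [hF, indicator, mem_Ioi, mem_Iic, mem_ofPred_eq]
    rw [this]
    exact (((by fun_prop : Measurable fun q : ℝ × ℝ × ℝ => ENNReal.ofReal (q.1 - q.2.1)).indicator
      hset2).indicator hset1).mul (hg.comp (by fun_prop))
  have e1 : ∀ x y, (∫⁻ t in Ico y x, ENNReal.ofReal (x - y) * g t) = ∫⁻ t, F x y t := by
    intro x y
    rw [← lintegral_indicator measurableSet_Ico]
    refine lintegral_congr fun t => ?_
    simp only [hF, indicator, mem_Ioi, mem_Iic, mem_Ico]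
    by_cases h1 : y ≤ t <;> by_cases h2 : t < x <;> simp [h1, h2]
  simp_rw [e1]
  have s1 : ∀ x, ∫⁻ y, (∫⁻ t, F x y t) ∂γ = ∫⁻ t, (∫⁻ y, F x y t ∂γ) := fun x =>
    lintegral_lintegral_swap (f := fun y t => F x y t)
      ((hFm.comp (by fun_prop : Measurable fun p : ℝ × ℝ => (x, p.1, p.2))).aemeasurable)
  simp_rw [s1]
  rw [lintegral_lintegral_swap]
  swap
  · have : Measurable fun p : ℝ × ℝ => ∫⁻ y, F p.1 y p.2 ∂γ :=
      Measurable.lintegral_prod_right'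
        (f := fun q : (ℝ × ℝ) × ℝ => F q.1.1 q.2 q.1.2)
        (hFm.comp (by fun_prop : Measurable fun q : (ℝ × ℝ) × ℝ => (q.1.1, q.2, q.1.2)))
    exact this.aemeasurable
  have e2 : ∀ t, ∫⁻ x, ∫⁻ y, F x y t ∂γ ∂γ = gaussianPDF 0 1 t * g t := by
    intro t
    rw [← gauss_kernel t, ← lintegral_indicator measurableSet_Ioi, ← lintegral_mul_const]
    · refine lintegral_congr fun x => ?_
      by_cases hx : t < x
      · rw [indicator_of_mem (by exact hx), ← lintegral_indicator measurableSet_Iic,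
          ← lintegral_mul_const]
        · refine lintegral_congr fun y => ?_
          simp [hF, hx]
        · exact (by fun_prop : Measurable fun y => ENNReal.ofReal (x - y)).indicator measurableSet_Iic
      · simp [hF, hx]
    · refine Measurable.indicator ?_ measurableSet_Ioi
      exact Measurable.lintegral_prod_right' (f := fun q : ℝ × ℝ => ENNReal.ofReal (q.1 - q.2))
        (by fun_prop)
  simp_rw [e2]
  rw [hγ, gaussianReal_of_var_ne_zero _ one_ne_zero,
    lintegral_withDensity_eq_lintegral_mul _ (measurable_gaussianPDF _ _) hg]
  rfl

open ProbabilityTheory in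
/-- sharp one-dimensional Gaussian inequality -/
lemma gauss_poincare_one (f f' : ℝ → ℝ) (hf : ∀ x, HasDerivAt f (f' x) x)
    (hf' : Continuous f') :
    ∫⁻ x, ∫⁻ y, ENNReal.ofReal ((f x - f y) ^ 2) ∂(gaussianReal 0 1) ∂(gaussianReal 0 1)
      ≤ 2 * ∫⁻ t, ENNReal.ofReal (f' t ^ 2) ∂(gaussianReal 0 1) := by
  set γ := gaussianReal 0 1 with hγ
  set K : ℝ → ℝ → ENNReal := fun x y =>
    ∫⁻ t in Ico y x, ENNReal.ofReal (x - y) * ENNReal.ofReal (f' t ^ 2) with hK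
  have hKm : Measurable fun p : ℝ × ℝ => K p.1 p.2 := by
    have hset : MeasurableSet {q : (ℝ × ℝ) × ℝ | q.1.2 ≤ q.2 ∧ q.2 < q.1.1} :=
      measurableSet_setOfPred.2 (Measurable.and
        (measurableSet_setOfPred.1 (measurableSet_le (f := fun q : (ℝ × ℝ) × ℝ => q.1.2)
          (g := fun q : (ℝ × ℝ) × ℝ => q.2) (by fun_prop) (by fun_prop)))
        (measurableSet_setOfPred.1 (measurableSet_lt (f := fun q : (ℝ × ℝ) × ℝ => q.2)
          (g := fun q : (ℝ × ℝ) × ℝ => q.1.1) (by fun_prop) (by fun_prop))))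
    have : (fun p : ℝ × ℝ => K p.1 p.2) = fun p : ℝ × ℝ => ∫⁻ t,
        {q : (ℝ × ℝ) × ℝ | q.1.2 ≤ q.2 ∧ q.2 < q.1.1}.indicator
        (fun q => ENNReal.ofReal (q.1.1 - q.1.2) * ENNReal.ofReal (f' q.2 ^ 2)) (p, t) := by
      ext p
      simp only [hK]
      rw [← lintegral_indicator measurableSet_Ico]
      rfl
    rw [this]
    refine Measurable.lintegral_prod_right' (Measurable.indicator ?_ hset)
    have := hf'.measurable
    fun_prop
  have hle : ∀ x y, ENNReal.ofReal ((f x - f y) ^ 2) ≤ K x y + K y x := by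
    intro x y
    rcases lt_trichotomy y x with h | h | h
    · exact (cs_interval_lintegral f f' hf hf' h).trans le_self_add
    · simp [h]
    · rw [← neg_sub, neg_sq]
      exact (cs_interval_lintegral f f' hf hf' h).trans le_add_self
  have hk1 : ∫⁻ x, ∫⁻ y, K x y ∂γ ∂γ = ∫⁻ t, ENNReal.ofReal (f' t ^ 2) ∂γ :=
    gauss_half _ (by have := hf'.measurable; fun_prop)
  have hk2 : ∫⁻ x, ∫⁻ y, K y x ∂γ ∂γ = ∫⁻ t, ENNReal.ofReal (f' t ^ 2) ∂γ := by
    rw [lintegral_lintegral_swap (f := fun x y => K y x) (hKm.comp measurable_swap).aemeasurable]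
    exact hk1
  calc _ ≤ ∫⁻ x, ∫⁻ y, (K x y + K y x) ∂γ ∂γ :=
        lintegral_mono fun x => lintegral_mono fun y => hle x y
    _ = ∫⁻ x, (∫⁻ y, K x y ∂γ + ∫⁻ y, K y x ∂γ) ∂γ := by
        refine lintegral_congr fun x => ?_
        exact lintegral_add_left (hKm.comp (by fun_prop : Measurable fun y : ℝ => (x, y))) _
    _ = _ := by
        rw [lintegral_add_left, hk1, hk2, two_mul]
        exact Measurable.lintegral_prod_right' (f := fun p : ℝ × ℝ => K p.1 p.2) hKm


lemma four_pt (A B C D : ℝ) :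
    ENNReal.ofReal ((A - D) ^ 2) + ENNReal.ofReal ((B - C) ^ 2)
      ≤ (ENNReal.ofReal ((A - B) ^ 2) + ENNReal.ofReal ((C - D) ^ 2))
        + (ENNReal.ofReal ((A - C) ^ 2) + ENNReal.ofReal ((B - D) ^ 2)) := by
  rw [← ENNReal.ofReal_add (by positivity) (by positivity),
    ← ENNReal.ofReal_add (by positivity) (by positivity),
    ← ENNReal.ofReal_add (by positivity) (by positivity),
    ← ENNReal.ofReal_add (by positivity) (by positivity)]
  apply ENNReal.ofReal_le_ofReal
  nlinarith [sq_nonneg (A - B - C + D)]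

/-- Efron--Stein inequality for two variables -/
lemma efron_two {α β : Type*} [MeasurableSpace α] [MeasurableSpace β]
    (μ : Measure α) (ν : Measure β) [IsProbabilityMeasure μ] [IsProbabilityMeasure ν]
    (f : α → β → ℝ) (hf : Measurable fun p : α × β => f p.1 p.2) :
    ∫⁻ p, ∫⁻ q, ENNReal.ofReal ((f p.1 p.2 - f q.1 q.2) ^ 2) ∂(μ.prod ν) ∂(μ.prod ν)
      ≤ (∫⁻ y, ∫⁻ x, ∫⁻ x', ENNReal.ofReal ((f x y - f x' y) ^ 2) ∂μ ∂μ ∂ν)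
        + ∫⁻ x, ∫⁻ y, ∫⁻ y', ENNReal.ofReal ((f x y - f x y') ^ 2) ∂ν ∂ν ∂μ := by
  set M := (μ.prod μ).prod (ν.prod ν) with hM
  have hswapx : MeasurePreserving (fun w : (α × α) × (β × β) => ((w.1.2, w.1.1), w.2)) M M :=
    (Measure.measurePreserving_swap (μ := μ) (ν := μ)).prod (MeasurePreserving.id (ν.prod ν))
  have hswapy : MeasurePreserving (fun w : (α × α) × (β × β) => (w.1, (w.2.2, w.2.1))) M M :=
    (MeasurePreserving.id (μ.prod μ)).prod (Measure.measurePreserving_swap (μ := ν) (ν := ν))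
  have hff : ∀ (g : (α × α) × (β × β) → α) (h : (α × α) × (β × β) → β), Measurable g →
      Measurable h → Measurable fun w => f (g w) (h w) := fun g h hg hh =>
    hf.comp (hg.prodMk hh)
  have m00 := hff (fun w => w.1.1) (fun w => w.2.1) (by fun_prop) (by fun_prop)
  have m01 := hff (fun w => w.1.1) (fun w => w.2.2) (by fun_prop) (by fun_prop)
  have m10 := hff (fun w => w.1.2) (fun w => w.2.1) (by fun_prop) (by fun_prop)
  have m11 := hff (fun w => w.1.2) (fun w => w.2.2) (by fun_prop) (by fun_prop)
  have hsq : ∀ g h : (α × α) × (β × β) → ℝ, Measurable g → Measurable h →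
    Measurable fun w => ENNReal.ofReal ((g w - h w) ^ 2) := fun g h hg hh => by fun_prop
  set T := ∫⁻ w, ENNReal.ofReal ((f w.1.1 w.2.1 - f w.1.2 w.2.2) ^ 2) ∂M with hT
  set U := ∫⁻ w, ENNReal.ofReal ((f w.1.1 w.2.1 - f w.1.2 w.2.1) ^ 2) ∂M with hU
  set V := ∫⁻ w, ENNReal.ofReal ((f w.1.1 w.2.1 - f w.1.1 w.2.2) ^ 2) ∂M with hV
  have hT' : ∫⁻ w, ENNReal.ofReal ((f w.1.2 w.2.1 - f w.1.1 w.2.2) ^ 2) ∂M = T :=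
    hswapx.lintegral_comp (hsq _ _ m00 m11)
  have hU' : ∫⁻ w, ENNReal.ofReal ((f w.1.1 w.2.2 - f w.1.2 w.2.2) ^ 2) ∂M = U :=
    hswapy.lintegral_comp (hsq _ _ m00 m10)
  have hV' : ∫⁻ w, ENNReal.ofReal ((f w.1.2 w.2.1 - f w.1.2 w.2.2) ^ 2) ∂M = V :=
    hswapx.lintegral_comp (hsq _ _ m00 m01)
  have key : T + T ≤ (U + U) + (V + V) := by
    calc T + T = ∫⁻ w, (ENNReal.ofReal ((f w.1.1 w.2.1 - f w.1.2 w.2.2) ^ 2)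
          + ENNReal.ofReal ((f w.1.2 w.2.1 - f w.1.1 w.2.2) ^ 2)) ∂M := by
          rw [lintegral_add_left (hsq _ _ m00 m11), hT']
      _ ≤ ∫⁻ w, ((ENNReal.ofReal ((f w.1.1 w.2.1 - f w.1.2 w.2.1) ^ 2)
          + ENNReal.ofReal ((f w.1.1 w.2.2 - f w.1.2 w.2.2) ^ 2))
          + (ENNReal.ofReal ((f w.1.1 w.2.1 - f w.1.1 w.2.2) ^ 2)
          + ENNReal.ofReal ((f w.1.2 w.2.1 - f w.1.2 w.2.2) ^ 2))) ∂M :=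
          lintegral_mono fun w => four_pt _ _ _ _
      _ = _ := by
          rw [lintegral_add_left (f := fun w => _ + _) ((hsq _ _ m00 m10).add (hsq _ _ m01 m11)),
            lintegral_add_left (hsq _ _ m00 m10), lintegral_add_left (hsq _ _ m00 m01),
            hU', hV']
  have key' : T ≤ U + V := by
    have : 2 * T ≤ 2 * (U + V) := by
      calc 2 * T = T + T := two_mul _
        _ ≤ _ := key
        _ = _ := by ring
    exact (ENNReal.mul_le_mul_iff_right (by simp) (by simp)).1 this
  have eT : ∫⁻ p, ∫⁻ q, ENNReal.ofReal ((f p.1 p.2 - f q.1 q.2) ^ 2) ∂(μ.prod ν) ∂(μ.prod ν)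
      = T := by
    have hmp : MeasurePreserving (fun z : (α × β) × (α × β) => ((z.1.1, z.2.1), (z.1.2, z.2.2)))
        ((μ.prod ν).prod (μ.prod ν)) M := by
      have a1 := measurePreserving_prodAssoc μ ν (μ.prod ν)
      have a2 := (MeasurePreserving.id μ).prod (measurePreserving_prodAssoc ν μ ν).symm
      have a3 := (MeasurePreserving.id μ).prod
        ((Measure.measurePreserving_swap (μ := ν) (ν := μ)).prod (MeasurePreserving.id ν))
      have a4 := (MeasurePreserving.id μ).prod (measurePreserving_prodAssoc μ ν ν)
      have a5 := (measurePreserving_prodAssoc μ μ (ν.prod ν)).symm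
      exact a5.comp (a4.comp (a3.comp (a2.comp a1)))
    rw [hT, ← hmp.lintegral_comp (hsq _ _ m00 m11)]
    exact (lintegral_prod _ ((hsq _ _ m00 m11).comp hmp.measurable).aemeasurable).symm
  have eU : U = ∫⁻ y, ∫⁻ x, ∫⁻ x', ENNReal.ofReal ((f x y - f x' y) ^ 2) ∂μ ∂μ ∂ν := by
    rw [hU, lintegral_prod_symm _ (hsq _ _ m00 m10).aemeasurable]
    have hm : Measurable fun p : β × (α × α) => ENNReal.ofReal ((f p.2.1 p.1 - f p.2.2 p.1) ^ 2) := by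
      have a1 : Measurable fun p : β × (α × α) => f p.2.1 p.1 :=
        hf.comp (by fun_prop : Measurable fun p : β × (α × α) => (p.2.1, p.1))
      have a2 : Measurable fun p : β × (α × α) => f p.2.2 p.1 :=
        hf.comp (by fun_prop : Measurable fun p : β × (α × α) => (p.2.2, p.1))
      fun_prop
    rw [lintegral_prod]
    · simp only [lintegral_const, measure_univ, mul_one]
      refine lintegral_congr fun y => ?_
      rw [lintegral_prod]
      exact (hm.comp measurable_prodMk_left).aemeasurable
    · have := hm.lintegral_prod_right' (ν := μ.prod μ)
      exact (this.comp measurable_fst).aemeasurable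
  have eV : V = ∫⁻ x, ∫⁻ y, ∫⁻ y', ENNReal.ofReal ((f x y - f x y') ^ 2) ∂ν ∂ν ∂μ := by
    rw [hV, lintegral_prod _ (hsq _ _ m00 m01).aemeasurable]
    have hm : Measurable fun p : α × (β × β) => ENNReal.ofReal ((f p.1 p.2.1 - f p.1 p.2.2) ^ 2) := by
      have a1 : Measurable fun p : α × (β × β) => f p.1 p.2.1 :=
        hf.comp (by fun_prop : Measurable fun p : α × (β × β) => (p.1, p.2.1))
      have a2 : Measurable fun p : α × (β × β) => f p.1 p.2.2 :=
        hf.comp (by fun_prop : Measurable fun p : α × (β × β) => (p.1, p.2.2))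
      fun_prop
    rw [lintegral_prod]
    · simp only [lintegral_const, measure_univ, mul_one]
      refine lintegral_congr fun x => ?_
      rw [lintegral_prod]
      exact (hm.comp measurable_prodMk_left).aemeasurable
    · have := hm.lintegral_prod_right' (ν := ν.prod ν)
      exact (this.comp measurable_fst).aemeasurable
  rw [eT, ← eU, ← eV]
  exact key'

lemma lintegral_pi_cons (γ : Measure ℝ) [IsProbabilityMeasure γ] (m : ℕ)
    (h : (Fin (m + 1) → ℝ) → ENNReal) (hh : Measurable h) :
    ∫⁻ x, h x ∂(Measure.pi fun _ => γ)
      = ∫⁻ p, h (Fin.cons p.1 p.2) ∂(γ.prod (Measure.pi fun _ : Fin m => γ)) := by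
  have := (measurePreserving_piFinSuccAbove (fun _ : Fin (m + 1) => γ) 0).symm
  rw [← this.lintegral_comp hh]
  refine lintegral_congr fun p => ?_
  congr 1
  exact Fin.insertNth_zero' p.1 p.2

lemma measurable_cons' (m : ℕ) :
    Measurable fun p : ℝ × (Fin m → ℝ) => (Fin.cons p.1 p.2 : Fin (m + 1) → ℝ) := by
  refine measurable_pi_iff.2 fun i => ?_
  refine Fin.cases ?_ (fun j => ?_) i
  · simpa using measurable_fst
  · simp only [Fin.cons_succ]; fun_prop

lemma efron_pi (γ : Measure ℝ) [IsProbabilityMeasure γ] (m : ℕ) :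
    ∀ f : (Fin m → ℝ) → ℝ, Measurable f →
    ∫⁻ x, ∫⁻ y, ENNReal.ofReal ((f x - f y) ^ 2) ∂(Measure.pi fun _ => γ) ∂(Measure.pi fun _ => γ)
      ≤ ∑ i, ∫⁻ x, ∫⁻ t, ∫⁻ s, ENNReal.ofReal
        ((f (Function.update x i t) - f (Function.update x i s)) ^ 2) ∂γ ∂γ
          ∂(Measure.pi fun _ => γ) := by
  induction m with
  | zero =>
    intro f hf
    have : ∀ x y : Fin 0 → ℝ, ENNReal.ofReal ((f x - f y) ^ 2) = 0 := fun x y => by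
      rw [Subsingleton.elim x y]; simp
    simp [this]
  | succ m ih =>
    intro f hf
    set π := Measure.pi fun _ : Fin m => γ with hπ
    have hfc : Measurable fun p : ℝ × (Fin m → ℝ) => f (Fin.cons p.1 p.2) :=
      hf.comp (measurable_cons' m)
    have hmeas : ∀ i : Fin (m + 1), Measurable fun x : Fin (m + 1) → ℝ => ∫⁻ t, ∫⁻ s,
        ENNReal.ofReal ((f (Function.update x i t) - f (Function.update x i s)) ^ 2) ∂γ ∂γ := by
      intro i
      have hu : Measurable fun q : (Fin (m + 1) → ℝ) × ℝ => Function.update q.1 i q.2 := by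
        refine measurable_pi_iff.2 fun j => ?_
        by_cases hj : j = i
        · subst hj; simpa using measurable_snd
        · simp only [Function.update_of_ne hj]; fun_prop
      have h1 : Measurable fun q : ((Fin (m + 1) → ℝ) × ℝ) × ℝ =>
          f (Function.update q.1.1 i q.1.2) := hf.comp (hu.comp measurable_fst)
      have h2 : Measurable fun q : ((Fin (m + 1) → ℝ) × ℝ) × ℝ =>
          f (Function.update q.1.1 i q.2) := hf.comp (hu.comp
            (by fun_prop : Measurable fun q : ((Fin (m + 1) → ℝ) × ℝ) × ℝ => (q.1.1, q.2)))
      have h3 : Measurable fun q : ((Fin (m + 1) → ℝ) × ℝ) × ℝ => ENNReal.ofReal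
        ((f (Function.update q.1.1 i q.1.2) - f (Function.update q.1.1 i q.2)) ^ 2) := by fun_prop
      exact (h3.lintegral_prod_right' (ν := γ)).lintegral_prod_right' (ν := γ)
    have hL : ∫⁻ x, ∫⁻ y, ENNReal.ofReal ((f x - f y) ^ 2)
        ∂(Measure.pi fun _ => γ) ∂(Measure.pi fun _ => γ)
        = ∫⁻ p, ∫⁻ q, ENNReal.ofReal ((f (Fin.cons p.1 p.2) - f (Fin.cons q.1 q.2)) ^ 2)
          ∂(γ.prod π) ∂(γ.prod π) := by
      rw [lintegral_pi_cons]
      · refine lintegral_congr fun p => ?_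
        rw [lintegral_pi_cons]
        fun_prop
      · refine Measurable.lintegral_prod_right' (f := fun z : (Fin (m+1) → ℝ) × (Fin (m+1) → ℝ) =>
          ENNReal.ofReal ((f z.1 - f z.2) ^ 2)) ?_
        fun_prop
    rw [hL]
    refine (efron_two γ π (fun a z => f (Fin.cons a z)) hfc).trans ?_
    rw [Fin.sum_univ_succ]
    refine add_le_add ?_ ?_
    · rw [lintegral_pi_cons _ _ _ (hmeas 0), lintegral_prod_symm]
      · simp [Fin.update_cons_zero, ← hπ]
      · exact ((hmeas 0).comp (measurable_cons' m)).aemeasurable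
    · calc _ ≤ ∫⁻ a, ∑ i, ∫⁻ x, ∫⁻ t, ∫⁻ s, ENNReal.ofReal
              ((f (Fin.cons a (Function.update x i t))
                - f (Fin.cons a (Function.update x i s))) ^ 2) ∂γ ∂γ ∂π ∂γ := by
            refine lintegral_mono fun a => ?_
            exact ih (fun z => f (Fin.cons a z)) (hfc.comp measurable_prodMk_left)
        _ = _ := by
            have e : ∀ i : Fin m, ∀ a, ∀ x : Fin m → ℝ, (∫⁻ t, ∫⁻ s, ENNReal.ofReal
              ((f (Fin.cons a (Function.update x i t))
                - f (Fin.cons a (Function.update x i s))) ^ 2) ∂γ ∂γ)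
                = (fun x : Fin (m + 1) → ℝ => ∫⁻ t, ∫⁻ s,
                  ENNReal.ofReal ((f (Function.update x i.succ t)
                    - f (Function.update x i.succ s)) ^ 2) ∂γ ∂γ) (Fin.cons a x) := by
              intro i a x
              simp only [Fin.cons_update]
            rw [lintegral_finsetSum]
            · refine Finset.sum_congr rfl fun i _ => ?_
              rw [lintegral_pi_cons _ _ _ (hmeas i.succ), lintegral_prod]
              · simp only [e, hπ]
              · exact ((hmeas i.succ).comp (measurable_cons' m)).aemeasurable
            · intro i _
              simp only [e]
              exact Measurable.lintegral_prod_right' (ν := π)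
                ((hmeas i.succ).comp (measurable_cons' m))


section uniq
variable {d : ℕ}

lemma charFun_inv (μ : Measure (EuclideanSpace ℝ (Fin d))) [IsFiniteMeasure μ]
    (hinv : ∀ L : EuclideanSpace ℝ (Fin d) ≃ₗᵢ[ℝ] EuclideanSpace ℝ (Fin d), μ.map L = μ)
    (s t : EuclideanSpace ℝ (Fin d)) (h : ‖s‖ = ‖t‖) : charFun μ s = charFun μ t := by
  set L := Submodule.reflection (ℝ ∙ (s - t))ᗮ with hL
  have hLs : L s = t := Submodule.reflection_sub h
  rw [← hLs]
  conv_rhs => rw [← hinv L]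
  rw [charFun_apply, charFun_apply, integral_map (by fun_prop) (by fun_prop)]
  simp [LinearIsometryEquiv.inner_map_map]

lemma inv_measure_unique (μ ν : Measure (EuclideanSpace ℝ (Fin d))) [IsFiniteMeasure μ]
    [IsFiniteMeasure ν] (r : ℝ) (hr : 0 < r)
    (hμ : ∀ᵐ x ∂μ, ‖x‖ = r) (hν : ∀ᵐ x ∂ν, ‖x‖ = r)
    (hμi : ∀ L : EuclideanSpace ℝ (Fin d) ≃ₗᵢ[ℝ] EuclideanSpace ℝ (Fin d), μ.map L = μ)
    (hνi : ∀ L : EuclideanSpace ℝ (Fin d) ≃ₗᵢ[ℝ] EuclideanSpace ℝ (Fin d), ν.map L = ν) :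
    ν univ • μ = μ univ • ν := by
  have f1 : IsFiniteMeasure (ν univ • μ) := Measure.smul_finite _ (measure_ne_top _ _)
  have f2 : IsFiniteMeasure (μ univ • ν) := Measure.smul_finite _ (measure_ne_top _ _)
  apply Measure.ext_of_charFun
  ext t
  have key : ∀ (μ ν : Measure (EuclideanSpace ℝ (Fin d))) [IsFiniteMeasure μ]
    [IsFiniteMeasure ν], (∀ᵐ x ∂ν, ‖x‖ = r) →
    (∀ L : EuclideanSpace ℝ (Fin d) ≃ₗᵢ[ℝ] EuclideanSpace ℝ (Fin d), μ.map L = μ) →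
    ∫ y, charFun μ ((‖t‖ / r) • y) ∂ν = (ν univ).toReal • charFun μ t := by
    intro μ ν _ _ hν hμi
    have : ∫ y, charFun μ ((‖t‖ / r) • y) ∂ν = ∫ y, charFun μ t ∂ν := by
      refine integral_congr_ae (hν.mono fun y hy => ?_)
      apply charFun_inv μ hμi
      rw [norm_smul, hy]
      simp [abs_of_pos hr, hr.ne']
    rw [this]
    simp [Measure.real]
  have h1 := key μ ν hν hμi
  have h2 := key ν μ hμ hνi
  have h3 : ∫ y, charFun μ ((‖t‖ / r) • y) ∂ν = ∫ x, charFun ν ((‖t‖ / r) • x) ∂μ := by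
    simp only [charFun_apply]
    rw [integral_integral_swap]
    · simp only [inner_smul_right, real_inner_comm]
    · refine Integrable.mono' (integrable_const (1 : ℝ)) ?_ (ae_of_all _ fun z => ?_)
      · apply Continuous.aestronglyMeasurable
        fun_prop
      · simp only [Function.uncurry]
        rw [Complex.norm_exp_ofReal_mul_I]
  have e : ∀ (c : ENNReal) (μ : Measure (EuclideanSpace ℝ (Fin d))),
      charFun (c • μ) t = c.toReal • charFun μ t := by
    intro c μ
    rw [charFun_apply, charFun_apply, integral_smul_measure]
  rw [e, e, ← h1, ← h2, h3]

end uniq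


section hausdorff

lemma sphere_hausdorff_lt_top (n : ℕ) (r : ℝ) (hr : 0 < r) :
    (μH[n] : Measure (EuclideanSpace ℝ (Fin (n + 1))))
      (Metric.sphere (0 : EuclideanSpace ℝ (Fin (n + 1))) r) < ⊤ := by
  apply (isCompact_sphere _ _).measure_lt_top_of_nhdsWithin
  intro p hp
  have hpr : ‖p‖ = r := by simpa using hp
  have hp0 : p ≠ 0 := by rw [← norm_pos_iff, hpr]; exact hr
  haveI : Fact (Module.finrank ℝ (EuclideanSpace ℝ (Fin (n + 1))) = n + 1) := ⟨by simp⟩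
  set b := OrthonormalBasis.fromOrthogonalSpanSingleton (𝕜 := ℝ) n hp0 with hb
  set F : (Fin n → ℝ) → EuclideanSpace ℝ (Fin (n + 1)) :=
    fun w => p + ∑ i, w i • (b i : EuclideanSpace ℝ (Fin (n + 1))) with hF
  have hin : ∀ w, ⟪p, F w⟫ = r ^ 2 := by
    intro w
    have : ∀ i, ⟪p, (b i : EuclideanSpace ℝ (Fin (n + 1)))⟫ = 0 := fun i =>
      Submodule.mem_orthogonal_singleton_iff_inner_right.1 (b i).2
    simp [hF, inner_add_right, inner_sum, inner_smul_right, this, hpr]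
  have hF0 : ∀ w, F w ≠ 0 := by
    intro w h0
    have := hin w
    rw [h0, inner_zero_right] at this
    have : 0 < r ^ 2 := by positivity
    linarith
  have hFc : ContDiff ℝ 1 F := by
    simp only [hF]
    fun_prop
  set g : (Fin n → ℝ) → EuclideanSpace ℝ (Fin (n + 1)) := fun w => (r * ‖F w‖⁻¹) • F w with hg
  have hgc : ContDiff ℝ 1 g :=
    (contDiff_const.mul ((hFc.norm ℝ hF0).inv fun w => norm_ne_zero_iff.2 (hF0 w))).smul hFc
  obtain ⟨K, hK⟩ := (hgc.locallyLipschitz.locallyLipschitzOn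
    (s := Metric.closedBall 0 (3 * r))).exists_lipschitzOnWith_of_compact
      (isCompact_closedBall _ _)
  have hfin : (μH[n] : Measure (EuclideanSpace ℝ (Fin (n + 1))))
      (g '' Metric.closedBall 0 (3 * r)) < ⊤ := by
    refine (hK.hausdorffMeasure_image_le (by positivity)).trans_lt ?_
    have h := hausdorffMeasure_pi_real (ι := Fin n)
    rw [Fintype.card_fin] at h
    rw [h]
    refine ENNReal.mul_lt_top ?_ (isCompact_closedBall _ _).measure_lt_top
    simp
  refine ⟨g '' Metric.closedBall 0 (3 * r), ?_, hfin⟩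
  have hopen : {x : EuclideanSpace ℝ (Fin (n + 1)) | r ^ 2 / 2 < ⟪p, x⟫} ∈ nhds p := by
    refine IsOpen.mem_nhds (isOpen_lt (by fun_prop) (by fun_prop)) ?_
    simp only [mem_ofPred_eq, real_inner_self_eq_norm_sq, hpr]
    have : 0 < r ^ 2 := by positivity
    linarith
  filter_upwards [mem_nhdsWithin_of_mem_nhds hopen, self_mem_nhdsWithin] with x hx hxS
  have hxr : ‖x‖ = r := by simpa using hxS
  replace hx : r ^ 2 / 2 < ⟪p, x⟫ := hx
  set c := ⟪p, x⟫ with hc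
  have hr2 : 0 < r ^ 2 := by positivity
  have hc0 : 0 < c := by linarith
  have hy : (r ^ 2 / c) • x - p ∈ (ℝ ∙ p)ᗮ := by
    rw [Submodule.mem_orthogonal_singleton_iff_inner_right, inner_sub_right, inner_smul_right,
      real_inner_self_eq_norm_sq, hpr, ← hc]
    field_simp
    ring
  set w : Fin n → ℝ := fun i => b.repr ⟨_, hy⟩ i with hw
  have hsum : ∑ i, w i • (b i : EuclideanSpace ℝ (Fin (n + 1))) = (r ^ 2 / c) • x - p := by
    have := congrArg Subtype.val (b.sum_repr ⟨_, hy⟩)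
    simpa using this
  have hFw : F w = (r ^ 2 / c) • x := by
    simp only [hF, hsum]; abel
  refine ⟨w, ?_, ?_⟩
  · rw [mem_closedBall_zero_iff, pi_norm_le_iff_of_nonneg (by positivity)]
    intro i
    have h1 : ‖w i‖ ≤ ‖b.repr ⟨_, hy⟩‖ := PiLp.norm_apply_le _ i
    rw [LinearIsometryEquiv.norm_map] at h1
    refine h1.trans ?_
    have h2 : ‖(r ^ 2 / c) • x - p‖ ≤ 3 * r := by
      refine (norm_sub_le _ _).trans ?_
      rw [norm_smul, hxr, hpr, Real.norm_of_nonneg (by positivity)]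
      have : r ^ 2 / c ≤ 2 := by rw [div_le_iff₀ hc0]; linarith
      nlinarith
    exact h2
  · simp only [hg, hFw, norm_smul, hxr, Real.norm_of_nonneg (by positivity : 0 ≤ r ^ 2 / c), smul_smul]
    have : r * (r ^ 2 / c * r)⁻¹ * (r ^ 2 / c) = 1 := by field_simp
    rw [this, one_smul]

lemma sphere_hausdorff_pos (n : ℕ) (hn : 1 ≤ n) (r : ℝ) (hr : 0 < r) :
    0 < (μH[n] : Measure (EuclideanSpace ℝ (Fin (n + 1))))
      (Metric.sphere (0 : EuclideanSpace ℝ (Fin (n + 1))) r) := by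
  set P : EuclideanSpace ℝ (Fin (n + 1)) → (Fin n → ℝ) := fun x i => x i.succ with hP
  have hL : LipschitzWith 1 P := by
    refine LipschitzWith.of_dist_le_mul fun x y => ?_
    rw [NNReal.coe_one, one_mul, dist_pi_le_iff dist_nonneg]
    intro i
    have := PiLp.norm_apply_le (x - y) i.succ
    rw [dist_eq_norm, dist_eq_norm]
    exact this
  have h1 := hL.hausdorffMeasure_image_le (d := n) (by positivity)
    (Metric.sphere (0 : EuclideanSpace ℝ (Fin (n + 1))) r)
  have h := hausdorffMeasure_pi_real (ι := Fin n)
  rw [Fintype.card_fin] at h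
  rw [h] at h1
  simp only [ENNReal.coe_one, ENNReal.one_rpow, one_mul] at h1
  refine lt_of_lt_of_le ?_ h1
  have hn' : (1 : ℝ) ≤ n := by exact_mod_cast hn
  have hsub : Metric.ball (0 : Fin n → ℝ) (r / n) ⊆
      P '' (Metric.sphere (0 : EuclideanSpace ℝ (Fin (n + 1))) r) := by
    intro w hw
    have hw' : ∀ i, ‖w i‖ < r / n := by
      rw [mem_ball_zero_iff] at hw
      exact fun i => (norm_le_pi_norm w i).trans_lt hw
    have hs : ∑ i, w i ^ 2 ≤ r ^ 2 := by
      calc ∑ i, w i ^ 2 ≤ ∑ i : Fin n, (r / n) ^ 2 := by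
            refine Finset.sum_le_sum fun i _ => ?_
            rw [← sq_abs]
            exact pow_le_pow_left₀ (abs_nonneg _) (hw' i).le 2
        _ = r ^ 2 / n := by simp; field_simp
        _ ≤ r ^ 2 := div_le_self (by positivity) hn'
    refine ⟨WithLp.toLp 2 (Fin.cons (√(r ^ 2 - ∑ i, w i ^ 2)) w), ?_, ?_⟩
    · rw [mem_sphere_zero_iff_norm, EuclideanSpace.norm_eq, Fin.sum_univ_succ]
      simp only [Fin.cons_zero, Fin.cons_succ, Real.norm_eq_abs, sq_abs]
      rw [Real.sq_sqrt (by linarith), sub_add_cancel, Real.sqrt_sq hr.le]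
    · ext i
      simp [hP]
  exact (Metric.measure_ball_pos _ _ (by positivity)).trans_le (measure_mono hsub)

end hausdorff


section ext
open ProbabilityTheory

abbrev EE (n : ℕ) := EuclideanSpace ℝ (Fin (n + 1))

noncomputable def proj (n : ℕ) (r : ℝ) (x : EE n) : EE n := (r / ‖x‖) • x

/-- tangential gradient -/
noncomputable def tgrad (n : ℕ) (r : ℝ) (u : EE n → ℝ) (p : EE n) : EE n :=
  gradient u p - ⟪gradient u p, r⁻¹ • p⟫ • (r⁻¹ • p)

/-- homogeneous extension of degree one -/
noncomputable def hext (n : ℕ) (r : ℝ) (u : EE n → ℝ) (x : EE n) : ℝ := ‖x‖ * u (proj n r x)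

/-- its gradient -/
noncomputable def hgrad (n : ℕ) (r : ℝ) (u : EE n → ℝ) (x : EE n) : EE n :=
  u (proj n r x) • (‖x‖⁻¹ • x) + r • tgrad n r u (proj n r x)

lemma continuous_gradient {n : ℕ} {u : EE n → ℝ} (hu : ContDiff ℝ (⊤ : ℕ∞) u) :
    Continuous (gradient u) := by
  have h1 : Continuous (fderiv ℝ u) := hu.continuous_fderiv (by simp)
  exact (InnerProductSpace.toDual ℝ (EE n)).symm.continuous.comp h1

lemma continuous_tgrad {n : ℕ} (r : ℝ) {u : EE n → ℝ} (hu : ContDiff ℝ (⊤ : ℕ∞) u) :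
    Continuous (tgrad n r u) := by
  have := continuous_gradient hu
  unfold tgrad
  fun_prop

lemma measurable_proj (n : ℕ) (r : ℝ) : Measurable (proj n r) := by
  unfold proj; fun_prop

lemma measurable_hext {n : ℕ} (r : ℝ) {u : EE n → ℝ} (hu : Continuous u) :
    Measurable (hext n r u) :=
  measurable_norm.mul (hu.measurable.comp (measurable_proj n r))

lemma measurable_hgrad {n : ℕ} (r : ℝ) {u : EE n → ℝ} (hu : ContDiff ℝ (⊤ : ℕ∞) u) :
    Measurable (hgrad n r u) := by
  have h1 := hu.continuous.measurable.comp (measurable_proj n r)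
  have h2 := (continuous_tgrad r hu).measurable.comp (measurable_proj n r)
  unfold hgrad
  exact (h1.smul (measurable_norm.inv.smul measurable_id)).add (h2.const_smul r)

lemma norm_proj {n : ℕ} {r : ℝ} (hr : 0 < r) {x : EE n} (hx : x ≠ 0) : ‖proj n r x‖ = r := by
  have : 0 < ‖x‖ := norm_pos_iff.2 hx
  rw [proj, norm_smul, Real.norm_of_nonneg (by positivity)]
  field_simp

lemma hgrad_norm_sq {n : ℕ} {r : ℝ} (hr : 0 < r) (u : EE n → ℝ) {x : EE n} (hx : x ≠ 0) :
    ‖hgrad n r u x‖ ^ 2 = u (proj n r x) ^ 2 + r ^ 2 * ‖tgrad n r u (proj n r x)‖ ^ 2 := by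
  have hN : 0 < ‖x‖ := norm_pos_iff.2 hx
  have hp := norm_proj hr hx
  have hx' : ‖x‖⁻¹ • x = r⁻¹ • proj n r x := by
    rw [proj, smul_smul]; congr 1; field_simp
  have h1 : ‖r⁻¹ • proj n r x‖ = 1 := by
    rw [norm_smul, hp, Real.norm_of_nonneg (by positivity)]; field_simp
  have horth : ⟪r⁻¹ • proj n r x, tgrad n r u (proj n r x)⟫ = 0 := by
    rw [tgrad, inner_sub_right, inner_smul_right, real_inner_self_eq_norm_sq, h1,
      real_inner_comm]
    ring
  rw [hgrad, hx', norm_add_sq_real, inner_smul_left, inner_smul_right, horth, norm_smul (u _),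
    norm_smul r (tgrad _ _ _ _), h1]
  simp [mul_pow]

lemma hext_line {n : ℕ} {r : ℝ} (hr : 0 < r) {u : EE n → ℝ} (hu : ContDiff ℝ (⊤ : ℕ∞) u)
    (c : ℝ → EE n) (e : EE n) (t : ℝ) (hc : HasDerivAt c e t) (h0 : c t ≠ 0) :
    HasDerivAt (fun t => hext n r u (c t)) ⟪hgrad n r u (c t), e⟫ t := by
  have hN : 0 < ‖c t‖ := norm_pos_iff.2 h0
  have dN : HasDerivAt (fun t => ‖c t‖) (⟪c t, e⟫ / ‖c t‖) t := by
    have h1 := hc.norm_sq.sqrt (by positivity)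
    have h2 : (fun y => √(‖c y‖ ^ 2)) = fun t => ‖c t‖ := by
      ext s; exact Real.sqrt_sq (norm_nonneg _)
    rw [h2, Real.sqrt_sq hN.le] at h1
    refine h1.congr_deriv ?_
    field_simp
  have dq : HasDerivAt (fun t => r / ‖c t‖) (-(r * (⟪c t, e⟫ / ‖c t‖)) / ‖c t‖ ^ 2) t := by
    refine ((hasDerivAt_const t r).div dN hN.ne').congr_deriv ?_
    simp
  have dp : HasDerivAt (fun t => proj n r (c t))
      ((r / ‖c t‖) • e + (-(r * (⟪c t, e⟫ / ‖c t‖)) / ‖c t‖ ^ 2) • c t) t := dq.smul hc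
  have hud : HasFDerivAt u (fderiv ℝ u (proj n r (c t))) (proj n r (c t)) :=
    (hu.differentiable (by simp) _).hasFDerivAt
  have du := hud.comp_hasDerivAt t dp
  have := dN.mul du
  refine this.congr_deriv ?_
  rw [← inner_gradient_left, hgrad, tgrad]
  simp only [Function.comp, proj, inner_add_left, inner_add_right, inner_sub_left, inner_smul_left,
    inner_smul_right, RCLike.conj_to_real]
  field_simp
  ring

lemma lintegral_update (γ : Measure ℝ) [IsProbabilityMeasure γ] {m : ℕ} (i : Fin (m + 1))
    (h : (Fin (m + 1) → ℝ) → ENNReal) (hh : Measurable h) :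
    ∫⁻ x, ∫⁻ t, h (Function.update x i t) ∂γ ∂(Measure.pi fun _ => γ)
      = ∫⁻ x, h x ∂(Measure.pi fun _ => γ) := by
  have mp := (measurePreserving_piFinSuccAbove (fun _ : Fin (m + 1) => γ) i).symm
  have hu : Measurable fun q : (Fin (m + 1) → ℝ) × ℝ => Function.update q.1 i q.2 := by
    refine measurable_pi_iff.2 fun j => ?_
    by_cases hj : j = i
    · subst hj; simpa using measurable_snd
    · simp only [Function.update_of_ne hj]; fun_prop
  have hm : Measurable fun x : Fin (m + 1) → ℝ => ∫⁻ t, h (Function.update x i t) ∂γ :=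
    (hh.comp hu).lintegral_prod_right' (ν := γ)
  rw [← mp.lintegral_comp hm, ← mp.lintegral_comp hh, lintegral_prod_symm, lintegral_prod_symm]
  · refine lintegral_congr fun z => ?_
    have : ∀ a t, Function.update ((MeasurableEquiv.piFinSuccAbove (fun _ => ℝ) i).symm (a, z)) i t
        = (MeasurableEquiv.piFinSuccAbove (fun _ => ℝ) i).symm (t, z) := by
      intro a t
      exact Fin.update_insertNth (α := fun _ => ℝ) i a t z
    simp only [this, lintegral_const, measure_univ, mul_one]
  · exact (hh.comp mp.measurable).aemeasurable
  · exact (hm.comp mp.measurable).aemeasurable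

lemma hext_poincare_pi {n : ℕ} (hn : 1 ≤ n) {r : ℝ} (hr : 0 < r) {u : EE n → ℝ}
    (hu : ContDiff ℝ (⊤ : ℕ∞) u) :
    ∫⁻ x, ∫⁻ y, ENNReal.ofReal ((hext n r u (WithLp.toLp 2 x) - hext n r u (WithLp.toLp 2 y)) ^ 2)
        ∂(Measure.pi fun _ => gaussianReal 0 1) ∂(Measure.pi fun _ => gaussianReal 0 1)
      ≤ 2 * ∫⁻ x, ENNReal.ofReal (‖hgrad n r u (WithLp.toLp 2 x)‖ ^ 2)
        ∂(Measure.pi fun _ => gaussianReal 0 1) := by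
  have hgm := measurable_hgrad r hu
  have htoLp : Measurable fun x : Fin (n + 1) → ℝ => (WithLp.toLp 2 x : EE n) := by fun_prop
  have hcoord : ∀ i : Fin (n + 1), Measurable fun x : Fin (n + 1) → ℝ =>
      ENNReal.ofReal ((hgrad n r u (WithLp.toLp 2 x) i) ^ 2) := by
    intro i
    have h1 : Measurable fun x : Fin (n + 1) → ℝ => hgrad n r u (WithLp.toLp 2 x) := hgm.comp htoLp
    have h2 : Measurable fun x : Fin (n + 1) → ℝ => hgrad n r u (WithLp.toLp 2 x) i :=
      (by fun_prop : Measurable fun y : EE n => y i).comp h1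
    fun_prop
  refine (efron_pi (gaussianReal 0 1) (n + 1) (fun x => hext n r u (WithLp.toLp 2 x))
    ((measurable_hext r hu.continuous).comp htoLp)).trans ?_
  calc _ ≤ ∑ i, ∫⁻ x, 2 * ∫⁻ t, ENNReal.ofReal
          ((hgrad n r u (WithLp.toLp 2 (Function.update x i t)) i) ^ 2) ∂(gaussianReal 0 1)
          ∂(Measure.pi fun _ => gaussianReal 0 1) := by
        refine Finset.sum_le_sum fun i _ => lintegral_mono_ae ?_
        obtain ⟨j, hj⟩ : ∃ j : Fin (n + 1), j ≠ i := by
          have : Nontrivial (Fin (n + 1)) := Fin.nontrivial_iff_two_le.2 (by omega)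
          exact exists_ne i
        have hna := nullSingletonClass_gaussianReal (μ := 0) (v := 1) one_ne_zero
        have hae : ∀ᵐ a ∂(gaussianReal 0 1), a ≠ 0 := by
          rw [ae_iff]; simp
        have := (Measure.quasiMeasurePreserving_eval (fun _ : Fin (n + 1) => gaussianReal 0 1)
          j).ae hae
        filter_upwards [this] with x hx
        have hx0 : x j ≠ 0 := hx
        have hc0 : ∀ t, (WithLp.toLp 2 (Function.update x i t) : EE n) ≠ 0 := by
          intro t h
          apply hx0
          have := congrArg (fun y : EE n => y j) h
          simpa [Function.update_of_ne hj] using this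
        have hcd : ∀ t, HasDerivAt (fun t => (WithLp.toLp 2 (Function.update x i t) : EE n))
            (EuclideanSpace.single i 1) t := by
          intro t
          have h := hasDerivAt_update x i t
          exact ((PiLp.continuousLinearEquiv 2 ℝ (fun _ : Fin (n + 1) => ℝ)).symm.toContinuousLinearMap.hasFDerivAt).comp_hasDerivAt t h
        have hcc : Continuous fun t => (WithLp.toLp 2 (Function.update x i t) : EE n) :=
          continuous_iff_continuousAt.2 fun t => (hcd t).continuousAt
        refine gauss_poincare_one _ _ (fun t => ?_) ?_
        · refine (hext_line hr hu _ _ t (hcd t) (hc0 t)).congr_deriv ?_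
          rw [EuclideanSpace.inner_single_right]
          simp
        · have hgc : Continuous fun t => hgrad n r u (WithLp.toLp 2 (Function.update x i t)) := by
            have hni : ∀ t, ‖(WithLp.toLp 2 (Function.update x i t) : EE n)‖ ≠ 0 := fun t =>
              norm_ne_zero_iff.2 (hc0 t)
            have hpc : Continuous fun t => proj n r (WithLp.toLp 2 (Function.update x i t)) :=
              (continuous_const.div hcc.norm hni).smul hcc
            exact ((hu.continuous.comp hpc).smul ((hcc.norm.inv₀ hni).smul hcc)).add
              (((continuous_tgrad r hu).comp hpc).const_smul r)
          exact (by fun_prop : Continuous fun y : EE n => y i).comp hgc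
    _ = ∑ i, 2 * ∫⁻ x, ENNReal.ofReal ((hgrad n r u (WithLp.toLp 2 x) i) ^ 2)
          ∂(Measure.pi fun _ => gaussianReal 0 1) := by
        refine Finset.sum_congr rfl fun i _ => ?_
        rw [lintegral_const_mul', lintegral_update (gaussianReal 0 1) i _ (hcoord i)]
        simp
    _ = _ := by
        rw [← Finset.mul_sum, ← lintegral_finsetSum _ (fun i _ => hcoord i)]
        congr 1
        refine lintegral_congr fun x => ?_
        rw [← ENNReal.ofReal_sum_of_nonneg (fun i _ => sq_nonneg _), EuclideanSpace.norm_sq_eq]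
        simp

lemma hext_poincare {n : ℕ} (hn : 1 ≤ n) {r : ℝ} (hr : 0 < r) {u : EE n → ℝ}
    (hu : ContDiff ℝ (⊤ : ℕ∞) u) :
    ∫⁻ x, ∫⁻ y, ENNReal.ofReal ((hext n r u x - hext n r u y) ^ 2)
        ∂(stdGaussian (EE n)) ∂(stdGaussian (EE n))
      ≤ 2 * ∫⁻ x, ENNReal.ofReal (‖hgrad n r u x‖ ^ 2) ∂(stdGaussian (EE n)) := by
  have htoLp : Measurable fun x : Fin (n + 1) → ℝ => (WithLp.toLp 2 x : EE n) := by fun_prop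
  have hm := measurable_hext r hu.continuous
  have hgm := measurable_hgrad r hu
  have h := hext_poincare_pi hn hr hu
  have hpair : Measurable fun z : EE n × EE n =>
    ENNReal.ofReal ((hext n r u z.1 - hext n r u z.2) ^ 2) := by fun_prop
  rw [← map_pi_eq_stdGaussian, lintegral_map _ htoLp, lintegral_map (by fun_prop) htoLp]
  · refine le_trans (le_of_eq ?_) h
    refine lintegral_congr fun x => ?_
    rw [lintegral_map (by fun_prop) htoLp]
  · exact hpair.lintegral_prod_right'

end ext


section fin
open ProbabilityTheory

noncomputable abbrev Gm (n : ℕ) : Measure (EE n) := stdGaussian (EE n)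

noncomputable def sg (n : ℕ) (r : ℝ) : Measure (EE n) :=
  (μH[n] : Measure (EE n)).restrict (Metric.sphere (0 : EE n) r)

lemma sg_inv (n : ℕ) (r : ℝ) (L : EE n ≃ₗᵢ[ℝ] EE n) : (sg n r).map L = sg n r := by
  have mp := L.toIsometryEquiv.measurePreserving_hausdorffMeasure (n : ℝ)
  have h2 := mp.restrict_preimage (s := Metric.sphere (0 : EE n) r)
    Metric.isClosed_sphere.measurableSet
  have h3 : L.toIsometryEquiv ⁻¹' Metric.sphere (0 : EE n) r = Metric.sphere (0 : EE n) r := by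
    ext x; simp
  rw [h3] at h2
  exact h2.map_eq

lemma sg_fin (n : ℕ) {r : ℝ} (hr : 0 < r) : IsFiniteMeasure (sg n r) :=
  ⟨by rw [sg, Measure.restrict_apply_univ]; exact sphere_hausdorff_lt_top n r hr⟩

lemma sg_ae (n : ℕ) (r : ℝ) : ∀ᵐ x ∂(sg n r), ‖x‖ = r := by
  rw [sg]
  filter_upwards [ae_restrict_mem Metric.isClosed_sphere.measurableSet] with x hx
  simpa using hx

lemma sg_pos {n : ℕ} (hn : 1 ≤ n) {r : ℝ} (hr : 0 < r) : 0 < (sg n r).real univ := by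
  have := sg_fin n hr
  rw [measureReal_def]
  refine ENNReal.toReal_pos ?_ (measure_ne_top _ _)
  rw [sg, Measure.restrict_apply_univ]
  exact (sphere_hausdorff_pos n hn r hr).ne'

lemma sg_integrable (n : ℕ) {r : ℝ} (hr : 0 < r) {f : EE n → ℝ} (hf : Continuous f) :
    Integrable f (sg n r) := by
  have := sg_fin n hr
  obtain ⟨C, hC⟩ := (isCompact_sphere (0 : EE n) r).exists_bound_of_continuousOn hf.continuousOn
  refine Integrable.of_bound hf.aestronglyMeasurable C ?_
  filter_upwards [sg_ae n r] with x hx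
  exact hC _ (by simpa using hx)

lemma Gm_ne (n : ℕ) : ∀ᵐ x ∂(Gm n), x ≠ 0 := by
  rw [Gm, ← map_pi_eq_stdGaussian]
  have htoLp : Measurable fun x : Fin (n + 1) → ℝ => (WithLp.toLp 2 x : EE n) := by fun_prop
  refine (ae_map_iff (p := fun x : EE n => x ≠ 0) htoLp.aemeasurable
    (measurableSet_singleton (0 : EE n)).compl).2 ?_
  have hna := nullSingletonClass_gaussianReal (μ := 0) (v := 1) one_ne_zero
  have hae : ∀ᵐ a ∂(gaussianReal 0 1), a ≠ 0 := by
    rw [ae_iff]; simp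
  have := (Measure.quasiMeasurePreserving_eval (fun _ : Fin (n + 1) => gaussianReal 0 1) 0).ae hae
  filter_upwards [this] with x hx h
  apply hx
  have := congrArg (fun y : EE n => y 0) h
  simpa using this

lemma Gm_pow (n k : ℕ) : Integrable (fun x => ‖x‖ ^ k) (Gm n) := by
  have h := IsGaussian.memLp_id (Gm n) k (by simp)
  exact h.integrable_norm_pow' 

lemma Gm_sq (n : ℕ) : ∫ x, ‖x‖ ^ 2 ∂(Gm n) = n + 1 := by
  have hi : ∀ i : Fin (n + 1), Integrable (fun x : EE n => (x i) ^ 2) (Gm n) := by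
    intro i
    refine (Gm_pow n 2).mono' (by fun_prop) (ae_of_all _ fun x => ?_)
    rw [Real.norm_of_nonneg (sq_nonneg _), ← sq_abs (x i), ← Real.norm_eq_abs]
    gcongr
    exact PiLp.norm_apply_le x i
  have h1 : ∀ i : Fin (n + 1), ∫ x : EE n, (x i) ^ 2 ∂(Gm n) = 1 := by
    intro i
    have hv := variance_dual_stdGaussian (E := EE n) (innerSL ℝ (EuclideanSpace.single i (1 : ℝ)))
    rw [variance_of_integral_eq_zero (by fun_prop) (integral_strongDual_stdGaussian _)] at hv
    simpa [EuclideanSpace.inner_single_left] using hv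
  have h2 : (fun x : EE n => ‖x‖ ^ 2) = fun x => ∑ i, (x i) ^ 2 := by
    ext x; rw [EuclideanSpace.norm_sq_eq]; simp
  rw [h2, integral_finsetSum _ fun i _ => hi i]
  simp [h1]

lemma proj_map {n : ℕ} (r : ℝ) (L : EE n ≃ₗᵢ[ℝ] EE n) (x : EE n) :
    proj n r (L x) = L (proj n r x) := by
  simp [proj]

noncomputable def nuk (n : ℕ) (r : ℝ) (k : ℕ) : Measure (EE n) :=
  ((Gm n).withDensity (fun x => ENNReal.ofReal (‖x‖ ^ k))).map (proj n r)

lemma nuk_fin (n : ℕ) (r : ℝ) (k : ℕ) : IsFiniteMeasure (nuk n r k) := by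
  have : IsFiniteMeasure ((Gm n).withDensity (fun x => ENNReal.ofReal (‖x‖ ^ k))) := by
    apply isFiniteMeasure_withDensity_ofReal
    exact (Gm_pow n k).hasFiniteIntegral
  unfold nuk
  infer_instance

lemma nuk_ae (n : ℕ) {r : ℝ} (hr : 0 < r) (k : ℕ) : ∀ᵐ x ∂(nuk n r k), ‖x‖ = r := by
  rw [nuk, ae_map_iff (measurable_proj n r).aemeasurable
    (measurableSet_eq_fun measurable_norm measurable_const)]
  refine (withDensity_absolutelyContinuous _ _).ae_le ?_
  filter_upwards [Gm_ne n] with x hx using norm_proj hr hx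

lemma nuk_lintegral (n : ℕ) (r : ℝ) (k : ℕ) (f : EE n → ENNReal) (hf : Measurable f) :
    ∫⁻ x, f x ∂(nuk n r k) = ∫⁻ x, ENNReal.ofReal (‖x‖ ^ k) * f (proj n r x) ∂(Gm n) := by
  rw [nuk, lintegral_map hf (measurable_proj n r), lintegral_withDensity_eq_lintegral_mul (g := fun x => f (proj n r x)) _
    (by fun_prop) (hf.comp (measurable_proj n r))]
  rfl

lemma nuk_inv (n : ℕ) (r : ℝ) (k : ℕ) (L : EE n ≃ₗᵢ[ℝ] EE n) :
    (nuk n r k).map L = nuk n r k := by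
  refine Measure.ext_of_lintegral _ fun f hf => ?_
  have hL : Measurable L := L.continuous.measurable
  rw [lintegral_map hf hL, nuk_lintegral _ _ _ (fun x => f (L x)) (hf.comp hL), nuk_lintegral _ _ _ _ hf]
  conv_rhs => rw [Gm, ← stdGaussian_map L]
  have := (hf.comp (measurable_proj n r))
  rw [lintegral_map _ hL]
  · simp [proj_map]
  · exact Measurable.mul (by fun_prop) this

lemma polar (n : ℕ) {r : ℝ} (hr : 0 < r) (k : ℕ) {f : EE n → ℝ} (hf : Continuous f) :
    (sg n r).real univ * ∫ x, ‖x‖ ^ k * f (proj n r x) ∂(Gm n)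
      = (∫ x, ‖x‖ ^ k ∂(Gm n)) * ∫ x, f x ∂(sg n r) := by
  have := sg_fin n hr
  have := nuk_fin n r k
  have h := inv_measure_unique (nuk n r k) (sg n r) r hr (nuk_ae n hr k) (sg_ae n r)
    (nuk_inv n r k) (sg_inv n r)
  have h1 : ∀ f : EE n → ℝ, Continuous f →
      ∫ x, f x ∂(nuk n r k) = ∫ x, ‖x‖ ^ k * f (proj n r x) ∂(Gm n) := by
    intro f hf
    rw [nuk, integral_map (measurable_proj n r).aemeasurable hf.aestronglyMeasurable,
      integral_withDensity_eq_integral_toReal_smul (by fun_prop) (by simp)]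
    refine integral_congr_ae (ae_of_all _ fun x => ?_)
    simp
  have h2 := congrArg (fun μ => ∫ x, f x ∂μ) h
  simp only [integral_smul_measure] at h2
  have h3 := h1 (fun _ => 1) continuous_const
  simp at h3
  rw [h1 f hf] at h2
  rw [← h3]
  exact h2

lemma hext_integrable_gen (n : ℕ) {r : ℝ} (hr : 0 < r) (k : ℕ) {f : EE n → ℝ}
    (hf : Continuous f) : Integrable (fun x => ‖x‖ ^ k * f (proj n r x)) (Gm n) := by
  obtain ⟨C, hC⟩ := (isCompact_sphere (0 : EE n) r).exists_bound_of_continuousOn hf.continuousOn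
  have hm : Measurable fun x => f (proj n r x) := hf.measurable.comp (measurable_proj n r)
  refine ((Gm_pow n k).mul_const C).mono'
    (Measurable.aestronglyMeasurable (Measurable.mul (by fun_prop) hm)) ?_
  filter_upwards [Gm_ne n] with x hx
  rw [norm_mul, Real.norm_of_nonneg (by positivity)]
  gcongr
  exact hC _ (by simpa using norm_proj hr hx)

lemma sphere_poincare {n : ℕ} (hn : 1 ≤ n) {r : ℝ} (hr : 0 < r) {u : EE n → ℝ}
    (hu : ContDiff ℝ (⊤ : ℕ∞) u) (h0 : ∫ x, u x ∂(sg n r) = 0) :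
    n * ∫ x, u x ^ 2 ∂(sg n r) ≤ r ^ 2 * ∫ x, ‖tgrad n r u x‖ ^ 2 ∂(sg n r) := by
  have hm := sg_pos hn hr
  have hc := hu.continuous
  have htc := continuous_tgrad r hu
  have hmh := measurable_hext (n := n) r hc
  set v := hext n r u with hv
  have hv1 : Integrable v (Gm n) := by
    have := hext_integrable_gen n hr 1 hc
    simp only [pow_one] at this
    exact this
  have hvs : (fun x => v x ^ 2) = fun x => ‖x‖ ^ 2 * (fun p => u p ^ 2) (proj n r x) := by
    ext x; simp [hv, hext, mul_pow]
  have hv2 : Integrable (fun x => v x ^ 2) (Gm n) := by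
    rw [hvs]; exact hext_integrable_gen n hr 2 (hc.pow 2)
  have hv0 : ∫ x, v x ∂(Gm n) = 0 := by
    have := polar n hr 1 hc
    rw [h0, mul_zero] at this
    have h := (mul_eq_zero.1 this).resolve_left hm.ne'
    simpa [hv, hext] using h
  have hp2 := polar n hr 2 (f := fun p => u p ^ 2) (hc.pow 2)
  rw [← hvs, Gm_sq] at hp2
  set gg : EE n → ℝ := fun p => u p ^ 2 + r ^ 2 * ‖tgrad n r u p‖ ^ 2 with hgg
  have hggc : Continuous gg := by fun_prop
  have hp0 := polar n hr 0 hggc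
  have hgi := hext_integrable_gen n hr 0 hggc
  simp only [pow_zero, one_mul, integral_const, probReal_univ, smul_eq_mul, mul_one] at hp0 hgi
  have hsplit : ∫ x, gg x ∂(sg n r) = ∫ x, u x ^ 2 ∂(sg n r)
      + r ^ 2 * ∫ x, ‖tgrad n r u x‖ ^ 2 ∂(sg n r) := by
    rw [hgg, integral_add (sg_integrable n hr (by fun_prop)) (sg_integrable n hr (by fun_prop)),
      integral_const_mul]
  have hP := hext_poincare hn hr hu
  have hR : ∫⁻ x, ENNReal.ofReal (‖hgrad n r u x‖ ^ 2) ∂(Gm n)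
      = ENNReal.ofReal (∫ x, gg (proj n r x) ∂(Gm n)) := by
    rw [ofReal_integral_eq_lintegral_ofReal hgi (ae_of_all _ fun x => by simp only [hgg]; positivity)]
    refine lintegral_congr_ae ?_
    filter_upwards [Gm_ne n] with x hx
    rw [hgrad_norm_sq hr u hx]
  have hin : ∀ x, ∫⁻ y, ENNReal.ofReal ((v x - v y) ^ 2) ∂(Gm n)
      = ENNReal.ofReal (v x ^ 2 + ∫ y, v y ^ 2 ∂(Gm n)) := by
    intro x
    have e : (fun y => (v x - v y) ^ 2) = fun y => (v x ^ 2 - 2 * v x * v y) + v y ^ 2 := by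
      ext y; ring
    have i1 : Integrable (fun y => v x ^ 2 - 2 * v x * v y) (Gm n) :=
      (integrable_const _).sub (hv1.const_mul _)
    rw [← ofReal_integral_eq_lintegral_ofReal (by rw [e]; exact i1.add hv2)
      (ae_of_all _ fun y => sq_nonneg _), e, integral_add i1 hv2,
      integral_sub (integrable_const _) (hv1.const_mul _), integral_const_mul, hv0]
    simp
  have hnn : 0 ≤ ∫ y, v y ^ 2 ∂(Gm n) := integral_nonneg fun y => sq_nonneg _
  have hL : ∫⁻ x, ∫⁻ y, ENNReal.ofReal ((v x - v y) ^ 2) ∂(Gm n) ∂(Gm n)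
      = ENNReal.ofReal (2 * ∫ y, v y ^ 2 ∂(Gm n)) := by
    simp_rw [hin]
    rw [← ofReal_integral_eq_lintegral_ofReal (f := fun x => v x ^ 2 + ∫ y, v y ^ 2 ∂(Gm n))
      (hv2.add (integrable_const _))
      (ae_of_all _ fun y => add_nonneg (sq_nonneg _) hnn), integral_add hv2 (integrable_const _)]
    simp [two_mul]
  have hgn : 0 ≤ ∫ x, gg (proj n r x) ∂(Gm n) :=
    integral_nonneg fun y => by simp only [hgg]; positivity
  rw [hL, hR, two_mul (ENNReal.ofReal _), ← ENNReal.ofReal_add hgn hgn,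
    ENNReal.ofReal_le_ofReal_iff (by positivity)] at hP
  have h3 : (sg n r).real univ * ∫ y, v y ^ 2 ∂(Gm n)
      ≤ (sg n r).real univ * ∫ x, gg (proj n r x) ∂(Gm n) := by
    exact mul_le_mul_of_nonneg_left (by linarith) hm.le
  rw [hp2, hp0, hsplit] at h3
  linarith

lemma coord_gradient (n : ℕ) (i : Fin (n + 1)) (p : EE n) :
    gradient (fun x : EE n => x i) p = EuclideanSpace.single i 1 := by
  apply HasGradientAt.gradient
  rw [hasGradientAt_iff_hasFDerivAt]
  have h : HasFDerivAt (fun x : EE n => x i) (EuclideanSpace.proj i : EE n →L[ℝ] ℝ) p :=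
    (EuclideanSpace.proj i : EE n →L[ℝ] ℝ).hasFDerivAt
  refine h.congr_fderiv ?_
  ext x
  simp [EuclideanSpace.inner_single_left]

lemma coord_tgrad (n : ℕ) {r : ℝ} (hr : 0 < r) (i : Fin (n + 1)) (p : EE n) (hp : ‖p‖ = r) :
    ‖tgrad n r (fun x : EE n => x i) p‖ ^ 2 = 1 - (p i) ^ 2 / r ^ 2 := by
  rw [tgrad, coord_gradient, norm_sub_sq_real, norm_smul, norm_smul, inner_smul_right,
    inner_smul_right, EuclideanSpace.inner_single_left, hp]
  simp only [EuclideanSpace.norm_single, norm_one, map_one, one_mul, mul_pow, Real.norm_eq_abs,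
    sq_abs]
  field_simp
  ring

lemma coord_mean (n : ℕ) (r : ℝ) (i : Fin (n + 1)) : ∫ x, x i ∂(sg n r) = 0 := by
  have h := sg_inv n r (LinearIsometryEquiv.neg ℝ)
  have h2 : ∫ x : EE n, x i ∂(sg n r)
      = ∫ x : EE n, x i ∂((sg n r).map (LinearIsometryEquiv.neg ℝ : EE n ≃ₗᵢ[ℝ] EE n)) := by
    rw [h]
  rw [integral_map (LinearIsometryEquiv.continuous _).aemeasurable
    (Continuous.aestronglyMeasurable (by fun_prop))] at h2
  simp [integral_neg] at h2
  linarith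

end fin

/-- Stability of the round ball of radius `r` about the origin for
the radial density `e^{δ(|x|)}` on `ℝ^{n+1}`:  `δ''(r) ≥ 0` if and only if the index
form is nonnegative on all smooth functions on the sphere `S_r` with mean zero, i.e.
`∫_{S_r} (|∇ᵀu|² − (n/r²) u²) dH^n + δ''(r) ∫_{S_r} u² dH^n ≥ 0`. -/
theorem ball_stable_iff_deriv2_nonneg
    (n : ℕ) (hn : 1 ≤ n) (r : ℝ) (hr : 0 < r) (δ : ℝ → ℝ)
    (hδ : ContDiffOn ℝ 2 δ (Set.Ioi 0)) :
    0 ≤ deriv (deriv δ) r ↔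
      ∀ u : EuclideanSpace ℝ (Fin (n + 1)) → ℝ, ContDiff ℝ (⊤ : ℕ∞) u →
        (∫ p in Metric.sphere (0 : EuclideanSpace ℝ (Fin (n + 1))) r, u p ∂(μH[n])) = 0 →
        0 ≤ (∫ p in Metric.sphere (0 : EuclideanSpace ℝ (Fin (n + 1))) r,
              (‖gradient u p - ⟪gradient u p, r⁻¹ • p⟫ • (r⁻¹ • p)‖ ^ 2
                - ((n : ℝ) / r ^ 2) * (u p) ^ 2) ∂(μH[n]))
            + deriv (deriv δ) r *
              ∫ p in Metric.sphere (0 : EuclideanSpace ℝ (Fin (n + 1))) r,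
                (u p) ^ 2 ∂(μH[n]) := by
  have hcd : ∀ u : EE n → ℝ, ContDiff ℝ (⊤ : ℕ∞) u →
      ∫ p, (‖tgrad n r u p‖ ^ 2 - ((n : ℝ) / r ^ 2) * (u p) ^ 2) ∂(sg n r)
        = ∫ p, ‖tgrad n r u p‖ ^ 2 ∂(sg n r) - ((n : ℝ) / r ^ 2) * ∫ p, (u p) ^ 2 ∂(sg n r) := by
    intro u hu
    have h1 := continuous_tgrad r hu
    have h2 := hu.continuous
    rw [integral_sub (sg_integrable n hr (by fun_prop)) (sg_integrable n hr (by fun_prop)),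
      integral_const_mul]
  constructor
  · intro hd u hu h0
    have hP := sphere_poincare hn hr hu h0
    have hS := hcd u hu
    have hn2 : 0 ≤ ∫ p, (u p) ^ 2 ∂(sg n r) := integral_nonneg fun p => sq_nonneg _
    change 0 ≤ ∫ p, (‖tgrad n r u p‖ ^ 2 - ((n : ℝ) / r ^ 2) * (u p) ^ 2) ∂(sg n r)
      + deriv (deriv δ) r * ∫ p, (u p) ^ 2 ∂(sg n r)
    rw [hS]
    refine add_nonneg ?_ (mul_nonneg hd hn2)
    rw [sub_nonneg, div_mul_eq_mul_div, div_le_iff₀ (by positivity)]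
    linarith
  · intro h
    have := sg_fin n hr
    have hm := sg_pos hn hr
    have hi : ∀ i : Fin (n + 1), 0 ≤ (sg n r).real univ
        - ((n + 1 : ℝ) / r ^ 2) * ∫ p : EE n, (p i) ^ 2 ∂(sg n r)
        + deriv (deriv δ) r * ∫ p : EE n, (p i) ^ 2 ∂(sg n r) := by
      intro i
      have hsm : ContDiff ℝ (⊤ : ℕ∞) (fun x : EE n => x i) := by fun_prop
      have h1 : 0 ≤ ∫ p, (‖tgrad n r (fun x : EE n => x i) p‖ ^ 2
          - ((n : ℝ) / r ^ 2) * (p i) ^ 2) ∂(sg n r)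
          + deriv (deriv δ) r * ∫ p : EE n, (p i) ^ 2 ∂(sg n r) := h _ hsm (coord_mean n r i)
      rw [hcd _ hsm] at h1
      have h2 : ∫ p, ‖tgrad n r (fun x : EE n => x i) p‖ ^ 2 ∂(sg n r)
          = (sg n r).real univ - (∫ p : EE n, (p i) ^ 2 ∂(sg n r)) / r ^ 2 := by
        have h3 : ∫ p, ‖tgrad n r (fun x : EE n => x i) p‖ ^ 2 ∂(sg n r)
            = ∫ p : EE n, (1 - (p i) ^ 2 / r ^ 2) ∂(sg n r) :=
          integral_congr_ae ((sg_ae n r).mono fun p hp => coord_tgrad n hr i p hp)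
        rw [h3, integral_sub (integrable_const _) (sg_integrable n hr (by fun_prop)),
          integral_div]
        simp
      rw [h2] at h1
      convert h1 using 2
      ring
    have hsum : ∑ i : Fin (n + 1), ∫ p : EE n, (p i) ^ 2 ∂(sg n r)
        = r ^ 2 * (sg n r).real univ := by
      rw [← integral_finsetSum _ fun i _ => sg_integrable n hr (by fun_prop)]
      have h3 : ∫ p : EE n, ∑ i, (p i) ^ 2 ∂(sg n r) = ∫ p : EE n, r ^ 2 ∂(sg n r) := by
        refine integral_congr_ae ((sg_ae n r).mono fun p hp => ?_)
        have h4 := EuclideanSpace.norm_sq_eq p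
        simp only [Real.norm_eq_abs, sq_abs] at h4
        simp only [← h4, hp]
      rw [h3]
      simp [mul_comm]
    have hs := Finset.sum_nonneg fun i (_ : i ∈ Finset.univ) => hi i
    rw [Finset.sum_add_distrib, Finset.sum_sub_distrib, ← Finset.mul_sum, ← Finset.mul_sum,
      hsum] at hs
    simp only [Finset.sum_const, Finset.card_univ, Fintype.card_fin, nsmul_eq_mul] at hs
    have e : ((n + 1 : ℕ) : ℝ) * (sg n r).real univ
        - ((n + 1 : ℝ) / r ^ 2) * (r ^ 2 * (sg n r).real univ) = 0 := by
      push_cast; field_simp; ring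
    rw [e, zero_add] at hs
    exact nonneg_of_mul_nonneg_left hs (by positivity)
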